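/- Let S be a Lalley–Gatzouras carpet. Then the Assouad dimension of S is at least β_x + β_y. -/

import Mathlib

open Set Metric Filter

/-- The Assouad dimension of a set `E` in a metric space: the infimum of all `α ≥ 0`
for which there is `C > 0` such that for every `x ∈ E` and all radii `0 < r ≤ R`,
the set `E ∩ B(x, R)` can be covered by at most `C · (R / r) ^ α` balls of radius `r`. -/
noncomputable def assouadDim {X : Type*} [PseudoMetricSpace X] (E : Set X) : ℝ :=
  sInf { α : ℝ | 0 ≤ α ∧ ∃ C : ℝ, 0 < C ∧ ∀ x ∈ E, ∀ r R : ℝ, 0 < r → r ≤ R →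
    ∃ F : Finset X, (F.card : ℝ) ≤ C * (R / r) ^ α ∧
      E ∩ Metric.ball x R ⊆ ⋃ y ∈ F, Metric.ball y r }

/-- The defining data of a Lalley–Gatzouras carpet: `m ≥ 2` rows, the `i`-th row
(for `0 ≤ i < m`) containing `n i ≥ 1` affine maps `A_{ij}(x,y) = (a i j • x + c i j, b i • y + d i)`
(for `0 ≤ j < n i`), with at least one row containing at least two maps, each map contracting
strictly more horizontally than vertically, the rows stacked disjointly in order inside `[0,1]`
vertically, and the maps of each row placed disjointly in order inside `[0,1]` horizontally. -/
structure LGData where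
  m : ℕ
  n : ℕ → ℕ
  a : ℕ → ℕ → ℝ
  b : ℕ → ℝ
  c : ℕ → ℕ → ℝ
  d : ℕ → ℝ
  hm : 2 ≤ m
  hn_one : ∀ i, i < m → 1 ≤ n i
  hn_two : ∃ i, i < m ∧ 2 ≤ n i
  ha_pos : ∀ i, i < m → ∀ j, j < n i → 0 < a i j
  ha_lt_b : ∀ i, i < m → ∀ j, j < n i → a i j < b i
  hb_lt_one : ∀ i, i < m → b i < 1
  hd_nonneg : 0 ≤ d 0
  hd_gap : ∀ i, i + 1 < m → d i + b i ≤ d (i + 1)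
  hd_top : d (m - 1) + b (m - 1) ≤ 1
  hc_nonneg : ∀ i, i < m → 0 ≤ c i 0
  hc_gap : ∀ i, i < m → ∀ j, j + 1 < n i → c i j + a i j ≤ c i (j + 1)
  hc_top : ∀ i, i < m → c i (n i - 1) + a i (n i - 1) ≤ 1

/-- The affine map `A_{ij}(x, y) = (a_{ij} x + c_{ij}, b_i y + d_i)`. -/
def lgMap (D : LGData) (ij : ℕ × ℕ) (p : ℝ × ℝ) : ℝ × ℝ :=
  (D.a ij.1 ij.2 * p.1 + D.c ij.1 ij.2, D.b ij.1 * p.2 + D.d ij.1)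

/-- The composition `A_{ω_1} ∘ ⋯ ∘ A_{ω_k}` along a word `ω`. -/
def lgWordMap (D : LGData) : List (ℕ × ℕ) → ℝ × ℝ → ℝ × ℝ
  | [] => id
  | ij :: w => lgMap D ij ∘ lgWordMap D w

/-- The plane `ℝ²` with the Euclidean metric, identifying a pair with a Euclidean point. -/
noncomputable def toE (p : ℝ × ℝ) : EuclideanSpace ℝ (Fin 2) :=
  (WithLp.equiv 2 (Fin 2 → ℝ)).symm ![p.1, p.2]

/-- The Lalley–Gatzouras carpet: the limit set
`S = ⋂_{k ≥ 1} ⋃_{ω ∈ 𝒥^k} (A_{ω_1} ∘ ⋯ ∘ A_{ω_k})([0,1]²)`, as a subset of the Euclidean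
plane. -/
def lgCarpet (D : LGData) : Set (EuclideanSpace ℝ (Fin 2)) :=
  ⋂ k ∈ {k : ℕ | 1 ≤ k},
    ⋃ w ∈ {w : List (ℕ × ℕ) | w.length = k ∧ ∀ ij ∈ w, ij.1 < D.m ∧ ij.2 < D.n ij.1},
      (fun p : ℝ × ℝ => toE (lgWordMap D w p)) '' (Set.Icc (0 : ℝ) 1 ×ˢ Set.Icc (0 : ℝ) 1)

/-- The composition along a word of the affine maps `t ↦ a j * t + c j` of the line. -/
def lineMap (a c : ℕ → ℝ) : List ℕ → ℝ → ℝ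
  | [], t => t
  | j :: w, t => a j * lineMap a c w t + c j

lemma lineMap_append (a c : ℕ → ℝ) (u v : List ℕ) (t : ℝ) :
    lineMap a c (u ++ v) t = lineMap a c u (lineMap a c v t) := by
  induction u with
  | nil => rfl
  | cons j u ih => simp [lineMap, ih]

lemma lineMap_replicate (a c : ℕ → ℝ) (k j : ℕ) (t : ℝ) :
    lineMap a c (List.replicate k j) t =
      a j ^ k * t + lineMap a c (List.replicate k j) 0 := by
  induction k with
  | zero => simp [lineMap]
  | succ k ih => simp only [List.replicate_succ, lineMap, ih, pow_succ]; ring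

lemma lineMap_mem_Icc {n : ℕ} {a c : ℕ → ℝ}
    (hmaps : ∀ j < n, ∀ t ∈ Icc (0 : ℝ) 1, a j * t + c j ∈ Icc (0 : ℝ) 1)
    {w : List ℕ} (hw : ∀ j ∈ w, j < n) {t : ℝ} (ht : t ∈ Icc (0 : ℝ) 1) :
    lineMap a c w t ∈ Icc (0 : ℝ) 1 := by
  induction w with
  | nil => exact ht
  | cons j w ih =>
    exact hmaps j (hw j (by simp)) _ (ih fun i hi => hw i (by simp [hi]))

/-- The expectation of `g` over words of length `N` with independent letters `j < n` of
weight `p j`. -/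
def wordMean (n : ℕ) (p : ℕ → ℝ) : ℕ → (List ℕ → ℝ) → ℝ
  | 0, g => g []
  | N + 1, g => ∑ j ∈ Finset.range n, p j * wordMean n p N fun w => g (j :: w)

section wordMean

variable {n : ℕ} {p : ℕ → ℝ}

lemma wordMean_mono (hp : ∀ j < n, 0 ≤ p j) {N : ℕ} {g h : List ℕ → ℝ}
    (hgh : ∀ w : List ℕ, w.length = N → (∀ j ∈ w, j < n) → g w ≤ h w) :
    wordMean n p N g ≤ wordMean n p N h := by
  induction N generalizing g h with
  | zero => exact hgh [] rfl (by simp)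
  | succ N ih =>
    refine Finset.sum_le_sum fun j hj => ?_
    have hj := Finset.mem_range.1 hj
    refine mul_le_mul_of_nonneg_left (ih fun w hw hw' => hgh _ (by simp [hw]) ?_) (hp j hj)
    simpa using ⟨hj, hw'⟩

lemma wordMean_const (hp : ∑ j ∈ Finset.range n, p j = 1) (N : ℕ) (t : ℝ) :
    wordMean n p N (fun _ => t) = t := by
  induction N with
  | zero => rfl
  | succ N ih => simp [wordMean, ih, ← Finset.sum_mul, hp]

lemma wordMean_const_mul (N : ℕ) (t : ℝ) (g : List ℕ → ℝ) :
    wordMean n p N (fun w => t * g w) = t * wordMean n p N g := by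
  induction N generalizing g with
  | zero => rfl
  | succ N ih => simp [wordMean, ih, Finset.mul_sum, mul_left_comm]

lemma wordMean_sum {ι : Type*} (F : Finset ι) (N : ℕ) (g : ι → List ℕ → ℝ) :
    wordMean n p N (fun w => ∑ y ∈ F, g y w) = ∑ y ∈ F, wordMean n p N (g y) := by
  induction N generalizing g with
  | zero => rfl
  | succ N ih =>
    simp only [wordMean, ih, Finset.mul_sum]
    exact Finset.sum_comm

end wordMean

/-- Words whose cylinder interval meets `[lo, hi]`. -/
def hitting (a c : ℕ → ℝ) (lo hi : ℝ) : Set (List ℕ) :=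
  {w | ∃ t ∈ Icc (0 : ℝ) 1, lineMap a c w t ∈ Icc lo hi}

/-- The nearest point to `t` in `[lo, hi]`. -/
noncomputable def clamp (lo hi t : ℝ) : ℝ := max lo (min t hi)

lemma clamp_mono (lo hi : ℝ) : Monotone (clamp lo hi) := fun _ _ h =>
  max_le_max le_rfl (min_le_min h le_rfl)

lemma clamp_of_mem {lo hi t : ℝ} (h₁ : lo ≤ t) (h₂ : t ≤ hi) : clamp lo hi t = t := by
  simp [clamp, h₁, h₂]

lemma clamp_sub_le {lo hi : ℝ} (h : lo ≤ hi) (s t : ℝ) :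
    clamp lo hi t - clamp lo hi s ≤ hi - lo := by
  have h₁ : clamp lo hi t ≤ hi := max_le h (min_le_right _ _)
  have h₂ : lo ≤ clamp lo hi s := le_max_left _ _
  linarith

lemma clamp_affine {a : ℝ} (ha : 0 < a) (c lo hi t : ℝ) :
    clamp ((lo - c) / a) ((hi - c) / a) t = (clamp lo hi (a * t + c) - c) / a := by
  have ht : t = (a * t + c - c) / a := by field_simp; ring
  have hm : Monotone fun s : ℝ => (s - c) / a := fun x y h => by
    simp only; gcongr
  unfold clamp
  conv_lhs => rw [ht]
  rw [hm.map_max, hm.map_min]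

/-- Ordered, non-overlapping affine copies of `[0, 1]` inside `[0, 1]`. -/
structure IsOrderedIFS (n : ℕ) (a c : ℕ → ℝ) : Prop where
  pos : ∀ j < n, 0 < a j
  lt_one : ∀ j < n, a j < 1
  nonneg : 0 ≤ c 0
  gap : ∀ j, j + 1 < n → c j + a j ≤ c (j + 1)
  top : c (n - 1) + a (n - 1) ≤ 1

namespace IsOrderedIFS

variable {n : ℕ} {a c : ℕ → ℝ}

lemma left_nonneg (h : IsOrderedIFS n a c) : ∀ j < n, 0 ≤ c j := by
  intro j
  induction j with
  | zero => exact fun _ => h.nonneg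
  | succ j ih =>
    intro hj
    linarith [ih (by omega), h.gap j hj, h.pos j (by omega)]

lemma right_le_one (h : IsOrderedIFS n a c) {j : ℕ} (hj : j < n) : c j + a j ≤ 1 := by
  induction hk : n - 1 - j generalizing j with
  | zero =>
    obtain rfl : j = n - 1 := by omega
    exact h.top
  | succ k ih =>
    linarith [ih (j := j + 1) (by omega) (by omega), h.gap j (by omega),
      h.pos (j + 1) (by omega)]

lemma mapsTo (h : IsOrderedIFS n a c) :
    ∀ j < n, ∀ t ∈ Icc (0 : ℝ) 1, a j * t + c j ∈ Icc (0 : ℝ) 1 := by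
  intro j hj t ht
  have h₁ := h.pos j hj
  have h₂ := h.left_nonneg j hj
  have h₃ := h.right_le_one hj
  exact ⟨by nlinarith [mul_nonneg h₁.le ht.1], by nlinarith [ht.2]⟩

lemma sum_sub_le (h : IsOrderedIFS n a c) {φ : ℝ → ℝ} (hφ : Monotone φ) :
    ∑ j ∈ Finset.range n, (φ (a j + c j) - φ (c j)) ≤ φ 1 - φ 0 := by
  have key : ∀ k, k + 1 ≤ n →
      ∑ j ∈ Finset.range (k + 1), (φ (a j + c j) - φ (c j)) ≤ φ (a k + c k) - φ 0 := by
    intro k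
    induction k with
    | zero =>
      intro _
      have := hφ h.nonneg
      simp only [zero_add, Finset.sum_range_one]
      linarith
    | succ k ih =>
      intro hk
      rw [Finset.sum_range_succ]
      have := hφ (h.gap k hk)
      rw [add_comm] at this
      linarith [ih (by omega)]
  rcases n with _ | k
  · simpa using hφ zero_le_one
  · refine (key k le_rfl).trans ?_
    have := hφ (h.right_le_one (Nat.lt_succ_self k))
    rw [add_comm] at this
    linarith

lemma wordMean_hitting_le_clamp (h : IsOrderedIFS n a c) {β δ θ : ℝ} (hβ0 : 0 ≤ β) (hβ : β ≤ 1)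
    (hsum : ∑ j ∈ Finset.range n, a j ^ β = 1) (hδ : 0 < δ) (hδ1 : δ ≤ 1)
    (hδa : ∀ j < n, δ ≤ a j) (hθ : ∀ j < n, a j ≤ θ) (hθ0 : 0 ≤ θ)
    (N : ℕ) (r lo hi : ℝ) (hr0 : 0 < r) (hr : θ ^ N ≤ r) (hr1 : r ≤ 1) (hlh : lo ≤ hi) :
    wordMean n (fun j => a j ^ β) N ((hitting a c lo hi).indicator 1) ≤
      δ⁻¹ * r ^ (β - 1) * (clamp (lo - r) (hi + r) 1 - clamp (lo - r) (hi + r) 0) := by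
  have hp : ∀ j < n, 0 ≤ a j ^ β := fun j hj => Real.rpow_nonneg (h.pos j hj).le _
  induction N generalizing r lo hi with
  | zero =>
    have hr1 : r = 1 := le_antisymm hr1 (by simpa using hr)
    subst hr1
    have hmono := clamp_mono (lo - 1) (hi + 1) zero_le_one
    by_cases hm : [] ∈ hitting a c lo hi
    · obtain ⟨t, ht, ht'⟩ := hm
      simp only [lineMap, mem_Icc] at ht ht'
      rw [clamp_of_mem (by linarith) (by linarith), clamp_of_mem (by linarith) (by linarith)]
      simp only [Real.one_rpow, mul_one, sub_zero]
      refine (Set.indicator_le_self' (by simp) _).trans ?_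
      simpa using (one_le_inv₀ hδ).2 hδ1
    · simp only [wordMean, Set.indicator_of_notMem hm]
      have : 0 ≤ δ⁻¹ := by positivity
      simp only [Real.one_rpow, mul_one]
      exact mul_nonneg this (by linarith)
  | succ N ih =>
    set φ := clamp (lo - r) (hi + r) with hφ
    have hφm : Monotone φ := clamp_mono _ _
    refine le_trans (Finset.sum_le_sum (g := fun j =>
      δ⁻¹ * r ^ (β - 1) * (φ (a j + c j) - φ (c j))) fun j hj => ?_) ?_
    · have hj := Finset.mem_range.1 hj
      have haj := h.pos j hj
      rcases le_or_gt r (a j) with hra | hra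
      · have hle : wordMean n (fun j => a j ^ β) N
            (fun w => (hitting a c lo hi).indicator 1 (j :: w)) ≤
            wordMean n (fun j => a j ^ β) N
              ((hitting a c ((lo - c j) / a j) ((hi - c j) / a j)).indicator 1) := by
          refine wordMean_mono hp fun w _ _ => le_of_eq ?_
          have : j :: w ∈ hitting a c lo hi ↔
              w ∈ hitting a c ((lo - c j) / a j) ((hi - c j) / a j) := by
            simp only [hitting, lineMap, mem_Icc, mem_ofPred_eq, div_le_iff₀ haj, le_div_iff₀ haj,
              sub_le_iff_le_add, le_sub_iff_add_le, mul_comm]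
          by_cases hm : j :: w ∈ hitting a c lo hi
          · simp [Set.indicator_of_mem hm, Set.indicator_of_mem (this.1 hm)]
          · simp [Set.indicator_of_notMem hm, Set.indicator_of_notMem (mt this.2 hm)]
        have hih := ih (r / a j) ((lo - c j) / a j) ((hi - c j) / a j) (by positivity)
          (by
            rw [le_div_iff₀ haj]
            refine le_trans ?_ hr
            rw [pow_succ]
            exact mul_le_mul_of_nonneg_left (hθ j hj) (pow_nonneg hθ0 _))
          ((div_le_one haj).2 hra) (by gcongr)
        have e₁ : (lo - c j) / a j - r / a j = (lo - r - c j) / a j := by ring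
        have e₂ : (hi - c j) / a j + r / a j = (hi + r - c j) / a j := by ring
        rw [e₁, e₂, clamp_affine haj, clamp_affine haj, ← hφ] at hih
        refine (mul_le_mul_of_nonneg_left (hle.trans hih) (hp j hj)).trans (le_of_eq ?_)
        rw [Real.div_rpow hr0.le haj.le, Real.rpow_sub_one haj.ne']
        have : a j ^ β ≠ 0 := (Real.rpow_pos_of_pos haj _).ne'
        simp only [mul_one, mul_zero, zero_add]
        field_simp
        ring
      · by_cases hm : c j ≤ hi ∧ lo ≤ a j + c j
        · rw [hφ, clamp_of_mem (by linarith) (by linarith),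
            clamp_of_mem (by linarith) (by linarith)]
          have h1 : wordMean n (fun j => a j ^ β) N
            (fun w => (hitting a c lo hi).indicator 1 (j :: w)) ≤ 1 := by
            refine (wordMean_mono hp fun w _ _ => ?_).trans (wordMean_const hsum N 1).le
            exact Set.indicator_le_self' (by simp) _
          have h2 : a j ^ (β - 1) ≤ δ⁻¹ := by
            refine (Real.rpow_le_rpow_of_nonpos hδ (hδa j hj) (by linarith)).trans ?_
            rw [← Real.rpow_neg_one]
            exact Real.rpow_le_rpow_of_exponent_ge hδ hδ1 (by linarith)
          have h3 : 1 ≤ r ^ (β - 1) :=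
            Real.one_le_rpow_of_pos_of_le_one_of_nonpos hr0 hr1 (by linarith)
          have h4 : a j ^ β = a j ^ (β - 1) * a j := by
            rw [Real.rpow_sub_one haj.ne']; field_simp
          calc _ ≤ a j ^ β := mul_le_of_le_one_right (hp j hj) h1
            _ = a j ^ (β - 1) * 1 * a j := by rw [h4, mul_one]
            _ ≤ δ⁻¹ * r ^ (β - 1) * a j := by gcongr
            _ = _ := by ring
        · have h1 : wordMean n (fun j => a j ^ β) N
            (fun w => (hitting a c lo hi).indicator 1 (j :: w)) ≤ 0 := by
            refine (wordMean_mono hp fun w _ hw => ?_).trans (wordMean_const hsum N 0).le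
            rw [Set.indicator_of_notMem]
            rintro ⟨t, ht, ht'⟩
            have hmem := lineMap_mem_Icc h.mapsTo hw ht
            simp only [lineMap, mem_Icc] at ht' hmem
            refine hm ⟨?_, ?_⟩ <;> nlinarith
          refine (mul_nonpos_of_nonneg_of_nonpos (hp j hj) h1).trans ?_
          have := hφm (show c j ≤ a j + c j by linarith)
          have := Real.rpow_nonneg hr0.le (β - 1)
          exact mul_nonneg (by positivity) (by linarith)
    · rw [← Finset.mul_sum]
      exact mul_le_mul_of_nonneg_left (h.sum_sub_le hφm)
        (mul_nonneg (by positivity) (Real.rpow_nonneg hr0.le _))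

/-- Frostman-type upper bound: an interval of radius `s * r` has mass at most a constant times
`r ^ β`, once words are long enough to resolve the scale `r`. -/
lemma exists_wordMean_hitting_le (h : IsOrderedIFS n a c) {β : ℝ} (hβ0 : 0 ≤ β) (hβ : β ≤ 1)
    (hsum : ∑ j ∈ Finset.range n, a j ^ β = 1) {s : ℝ} (hs : 0 ≤ s) :
    ∃ C > 0, ∀ r, 0 < r → r ≤ 1 → ∃ N, ∀ x,
      wordMean n (fun j => a j ^ β) N
        ((hitting a c (x - s * r) (x + s * r)).indicator 1) ≤ C * r ^ β := by
  have hn : (Finset.range n).Nonempty := by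
    by_contra hne
    rw [Finset.not_nonempty_iff_eq_empty] at hne
    simp [hne] at hsum
  obtain ⟨i, hi, hmin⟩ := Finset.exists_min_image _ a hn
  obtain ⟨k, hk, hmax⟩ := Finset.exists_max_image _ a hn
  simp only [Finset.mem_range] at hi hmin hk hmax
  have hδ := h.pos i hi
  refine ⟨(a i)⁻¹ * (2 * s + 2), by positivity, fun r hr0 hr1 => ?_⟩
  obtain ⟨N, hN⟩ := exists_pow_lt_of_lt_one hr0 (h.lt_one k hk)
  refine ⟨N, fun x => (h.wordMean_hitting_le_clamp hβ0 hβ hsum hδ (h.lt_one i hi).le hmin hmax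
    (h.pos k hk).le N r _ _ hr0 hN.le hr1 (by nlinarith [mul_nonneg hs hr0.le])).trans ?_⟩
  refine (mul_le_mul_of_nonneg_left (clamp_sub_le (by nlinarith [mul_nonneg hs hr0.le]) _ _)
    (by have := Real.rpow_nonneg hr0.le (β - 1); positivity)).trans (le_of_eq ?_)
  rw [Real.rpow_sub_one hr0.ne']
  field_simp
  ring

end IsOrderedIFS

section plane

@[simp] lemma toE_apply_zero (p : ℝ × ℝ) : toE p 0 = p.1 := rfl

@[simp] lemma toE_apply_one (p : ℝ × ℝ) : toE p 1 = p.2 := rfl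

lemma abs_coord_sub_le_dist (x y : EuclideanSpace ℝ (Fin 2)) (i : Fin 2) :
    |x i - y i| ≤ dist x y := by
  rw [dist_eq_norm]
  exact PiLp.norm_apply_le (x - y) i

lemma dist_lt_of_coords {x y : EuclideanSpace ℝ (Fin 2)} {s : ℝ} (hs : 0 < s)
    (h : ∀ i, |x i - y i| ≤ s) : dist x y < 2 * s := by
  rw [EuclideanSpace.dist_eq, Fin.sum_univ_two, Real.sqrt_lt' (by positivity)]
  simp only [Real.dist_eq]
  have h₀ := pow_le_pow_left₀ (abs_nonneg _) (h 0) 2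
  have h₁ := pow_le_pow_left₀ (abs_nonneg _) (h 1) 2
  nlinarith [pow_pos hs 2]

/-- The plane is doubling, with exponent `2`. -/
lemma exists_finset_cover_ball (x : EuclideanSpace ℝ (Fin 2)) {r R : ℝ} (hr : 0 < r)
    (hrR : r ≤ R) : ∃ F : Finset (EuclideanSpace ℝ (Fin 2)),
      (F.card : ℝ) ≤ 49 * (R / r) ^ (2 : ℝ) ∧ Metric.ball x R ⊆ ⋃ y ∈ F, Metric.ball y r := by
  classical
  set N := ⌈2 * R / r⌉₊ with hN
  set I := Finset.Icc (-(N : ℤ)) N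
  refine ⟨(I ×ˢ I).image fun k => toE (x 0 + k.1 * (r / 2), x 1 + k.2 * (r / 2)), ?_, ?_⟩
  · have h1 : 1 ≤ R / r := (one_le_div hr).2 hrR
    have hN' : (N : ℝ) ≤ 3 * (R / r) := by
      have := (Nat.ceil_lt_add_one (a := 2 * R / r) (by have := hr.trans_le hrR; positivity)).le
      have e : 2 * R / r = 2 * (R / r) := by ring
      rw [← hN, e] at this
      linarith
    have hI : (I.card : ℝ) ≤ 7 * (R / r) := by
      have : I.card = 2 * N + 1 := by simp only [I, Int.card_Icc]; omega
      rw [this]; push_cast; linarith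
    calc _ ≤ ((I ×ˢ I).card : ℝ) := by exact_mod_cast Finset.card_image_le
      _ = (I.card : ℝ) ^ 2 := by rw [Finset.card_product]; push_cast; ring
      _ ≤ (7 * (R / r)) ^ 2 := by gcongr
      _ = 49 * (R / r) ^ (2 : ℝ) := by rw [Real.rpow_two]; ring
  · intro z hz
    have key : ∀ i, ∃ k ∈ I, |z i - (x i + (k : ℝ) * (r / 2))| ≤ r / 2 := by
      intro i
      have hlt := (abs_coord_sub_le_dist z x i).trans_lt (Metric.mem_ball.1 hz)
      have hq : z i - x i = (z i - x i) / (r / 2) * (r / 2) := by field_simp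
      set q := (z i - x i) / (r / 2) with hq_def
      have hqN : |q| ≤ N := by
        refine le_trans ?_ (Nat.le_ceil _)
        rw [hq_def, abs_div, abs_of_pos (half_pos hr), div_le_div_iff₀ (by positivity) hr]
        nlinarith
      obtain ⟨h₁, h₂⟩ := abs_le.1 hqN
      refine ⟨⌊q⌋, Finset.mem_Icc.2 ⟨Int.le_floor.2 (by push_cast; exact h₁), ?_⟩, ?_⟩
      · exact_mod_cast (Int.floor_le q).trans h₂
      · have h₃ := Int.floor_le q
        have h₄ := Int.lt_floor_add_one q
        rw [abs_le]
        constructor <;> nlinarith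
    obtain ⟨k, hk, hk'⟩ := key 0
    obtain ⟨l, hl, hl'⟩ := key 1
    simp only [mem_iUnion, Finset.mem_image, Finset.mem_product, exists_prop]
    refine ⟨_, ⟨(k, l), ⟨hk, hl⟩, rfl⟩, ?_⟩
    rw [Metric.mem_ball]
    refine (dist_lt_of_coords (s := r / 2) (by positivity) ?_).trans_le (by linarith)
    intro i
    fin_cases i
    · simpa using hk'
    · simpa using hl'

end plane

namespace LGData

variable (D : LGData)

lemma b_pos {i : ℕ} (hi : i < D.m) : 0 < D.b i :=
  (D.ha_pos i hi 0 (D.hn_one i hi)).trans (D.ha_lt_b i hi 0 (D.hn_one i hi))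

lemma isOrderedIFS_row {i : ℕ} (hi : i < D.m) : IsOrderedIFS (D.n i) (D.a i) (D.c i) where
  pos := D.ha_pos i hi
  lt_one j hj := (D.ha_lt_b i hi j hj).trans (D.hb_lt_one i hi)
  nonneg := D.hc_nonneg i hi
  gap := D.hc_gap i hi
  top := D.hc_top i hi

lemma isOrderedIFS_rows : IsOrderedIFS D.m D.b D.d where
  pos _ hi := D.b_pos hi
  lt_one := D.hb_lt_one
  nonneg := D.hd_nonneg
  gap := D.hd_gap
  top := D.hd_top

/-- Words in the alphabet of the carpet. -/
def IsWord (w : List (ℕ × ℕ)) : Prop := ∀ ij ∈ w, ij.1 < D.m ∧ ij.2 < D.n ij.1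

lemma wordMap_append (u v : List (ℕ × ℕ)) (p : ℝ × ℝ) :
    lgWordMap D (u ++ v) p = lgWordMap D u (lgWordMap D v p) := by
  induction u with
  | nil => rfl
  | cons ij u ih => simp [lgWordMap, ih]

lemma wordMap_snd (w : List (ℕ × ℕ)) (p : ℝ × ℝ) :
    (lgWordMap D w p).2 = lineMap D.b D.d (w.map Prod.fst) p.2 := by
  induction w with
  | nil => rfl
  | cons ij w ih => simp [lgWordMap, lgMap, lineMap, ih]

lemma wordMap_row_fst (i : ℕ) (w : List ℕ) (p : ℝ × ℝ) :
    (lgWordMap D (w.map (Prod.mk i)) p).1 = lineMap (D.a i) (D.c i) w p.1 := by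
  induction w with
  | nil => rfl
  | cons j w ih => simp [lgWordMap, lgMap, lineMap, ih]

lemma wordMap_mem {w : List (ℕ × ℕ)} (hw : D.IsWord w) {p : ℝ × ℝ}
    (hp : p ∈ Icc (0 : ℝ) 1 ×ˢ Icc (0 : ℝ) 1) :
    lgWordMap D w p ∈ Icc (0 : ℝ) 1 ×ˢ Icc (0 : ℝ) 1 := by
  induction w with
  | nil => exact hp
  | cons ij w ih =>
    obtain ⟨hi, hj⟩ := hw ij (by simp)
    obtain ⟨h₁, h₂⟩ := ih fun k hk => hw k (by simp [hk])
    exact ⟨(D.isOrderedIFS_row hi).mapsTo _ hj _ h₁, D.isOrderedIFS_rows.mapsTo _ hi _ h₂⟩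

/-- The fixed point of the first map of row `i`. -/
noncomputable def fixedPoint (i : ℕ) : ℝ × ℝ :=
  (D.c i 0 / (1 - D.a i 0), D.d i / (1 - D.b i))

lemma fixedPoint_mem {i : ℕ} (hi : i < D.m) :
    D.fixedPoint i ∈ Icc (0 : ℝ) 1 ×ˢ Icc (0 : ℝ) 1 := by
  have key : ∀ {n : ℕ} {a c : ℕ → ℝ}, IsOrderedIFS n a c → ∀ j < n,
      c j / (1 - a j) ∈ Icc (0 : ℝ) 1 := by
    intro n a c h j hj
    have h₁ : 0 < 1 - a j := by linarith [h.lt_one j hj]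
    exact ⟨div_nonneg (h.left_nonneg j hj) h₁.le,
      (div_le_one h₁).2 (by linarith [h.right_le_one hj])⟩
  exact ⟨key (D.isOrderedIFS_row hi) 0 (D.hn_one i hi), key D.isOrderedIFS_rows i hi⟩

lemma wordMap_replicate_fixedPoint {i : ℕ} (hi : i < D.m) (k : ℕ) :
    lgWordMap D (List.replicate k (i, 0)) (D.fixedPoint i) = D.fixedPoint i := by
  induction k with
  | zero => rfl
  | succ k ih =>
    have ha := (D.isOrderedIFS_row hi).lt_one 0 (D.hn_one i hi)
    have hb := D.hb_lt_one i hi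
    have ha' : 1 - D.a i 0 ≠ 0 := by linarith
    have hb' : 1 - D.b i ≠ 0 := by linarith
    simp only [List.replicate_succ, lgWordMap, Function.comp, ih]
    simp only [lgMap, fixedPoint]
    ext <;> simp only <;> field_simp <;> ring

lemma toE_wordMap_fixedPoint_mem {i : ℕ} (hi : i < D.m) {w : List (ℕ × ℕ)} (hw : D.IsWord w) :
    toE (lgWordMap D w (D.fixedPoint i)) ∈ lgCarpet D := by
  simp only [lgCarpet, mem_iInter, mem_iUnion]
  intro k _
  have hlong : D.IsWord (w ++ List.replicate k (i, 0)) := by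
    intro ij hij
    rcases List.mem_append.1 hij with h | h
    · exact hw ij h
    · rw [List.eq_of_mem_replicate h]
      exact ⟨hi, D.hn_one i hi⟩
  refine ⟨(w ++ List.replicate k (i, 0)).take k,
    ⟨by simp, fun ij hij => hlong ij (List.mem_of_mem_take hij)⟩,
    lgWordMap D ((w ++ List.replicate k (i, 0)).drop k) (D.fixedPoint i),
    D.wordMap_mem (fun ij hij => hlong ij (List.mem_of_mem_drop hij)) (D.fixedPoint_mem hi), ?_⟩
  simp only
  rw [← D.wordMap_append, List.take_append_drop, D.wordMap_append,
    D.wordMap_replicate_fixedPoint hi]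

/-- For each `N` there is a scale `a ^ K` at which at least `N` further steps in row `i` fit
before the height becomes comparable to the width. -/
lemma exists_balanced_lengths {i : ℕ} (hi : i < D.m) (N : ℕ) :
    ∃ K Q : ℕ, D.b i ^ (K + N + Q) ≤ D.a i 0 ^ K ∧
      D.b i * D.a i 0 ^ K ≤ D.b i ^ (K + N + Q) := by
  have ha := D.ha_pos i hi 0 (D.hn_one i hi)
  have hab := D.ha_lt_b i hi 0 (D.hn_one i hi)
  have hb := D.b_pos hi
  have hb1 := D.hb_lt_one i hi
  obtain ⟨K, hK⟩ := exists_pow_lt_of_lt_one (pow_pos hb N) ((div_lt_one hb).2 hab)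
  rw [div_pow, div_lt_iff₀ (pow_pos hb K), ← pow_add, add_comm N K] at hK
  have hex : ∃ Q, D.b i ^ (K + N + Q) ≤ D.a i 0 ^ K := by
    obtain ⟨Q, hQ⟩ := exists_pow_lt_of_lt_one (pow_pos ha K) hb1
    exact ⟨Q, (pow_le_pow_of_le_one hb.le hb1.le (by omega)).trans hQ.le⟩
  classical
  refine ⟨K, Nat.find hex, Nat.find_spec hex, ?_⟩
  rcases hQ : Nat.find hex with _ | Q
  · have := Nat.find_spec hex
    rw [hQ, add_zero] at this
    linarith
  · have := Nat.find_min hex (m := Q) (by omega)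
    rw [← add_assoc, pow_succ, mul_comm]
    exact mul_le_mul_of_nonneg_right (not_le.1 this).le hb.le

/-- The word made of `K` copies of the first letter of row `i`, the word `w` in row `i`, `Q` more
copies of the first letter, and the first letters of the rows listed in `v`. -/
def squareWord (i K Q : ℕ) (w v : List ℕ) : List (ℕ × ℕ) :=
  (List.replicate K 0 ++ w).map (Prod.mk i) ++
    (List.replicate Q (i, 0) ++ v.map fun k => (k, 0))

variable {D}

lemma isWord_tail {i : ℕ} (hi : i < D.m) (Q : ℕ) {v : List ℕ} (hv : ∀ k ∈ v, k < D.m) :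
    D.IsWord (List.replicate Q (i, 0) ++ v.map fun k => (k, 0)) := by
  intro ij hij
  rcases List.mem_append.1 hij with h | h
  · rw [List.eq_of_mem_replicate h]
    exact ⟨hi, D.hn_one i hi⟩
  · obtain ⟨k, hk, rfl⟩ := List.mem_map.1 h
    exact ⟨hv k hk, D.hn_one k (hv k hk)⟩

lemma isWord_squareWord {i : ℕ} (hi : i < D.m) (K Q : ℕ) {w v : List ℕ}
    (hw : ∀ j ∈ w, j < D.n i) (hv : ∀ k ∈ v, k < D.m) : D.IsWord (squareWord i K Q w v) := by
  intro ij hij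
  rcases List.mem_append.1 hij with h | h
  · obtain ⟨j, hj, rfl⟩ := List.mem_map.1 h
    rcases List.mem_append.1 hj with h | h
    · rw [List.eq_of_mem_replicate h]
      exact ⟨hi, D.hn_one i hi⟩
    · exact ⟨hi, hw j h⟩
  · exact isWord_tail hi Q hv ij h

lemma wordMap_squareWord_fst {i : ℕ} (hi : i < D.m) (K Q : ℕ) {w v : List ℕ}
    (hv : ∀ k ∈ v, k < D.m) {p : ℝ × ℝ} (hp : p ∈ Icc (0 : ℝ) 1 ×ˢ Icc (0 : ℝ) 1) :
    ∃ t ∈ Icc (0 : ℝ) 1, (lgWordMap D (squareWord i K Q w v) p).1 =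
      D.a i 0 ^ K * lineMap (D.a i) (D.c i) w t +
        lineMap (D.a i) (D.c i) (List.replicate K 0) 0 := by
  refine ⟨_, (D.wordMap_mem (isWord_tail hi Q hv) hp).1, ?_⟩
  rw [squareWord, D.wordMap_append, D.wordMap_row_fst, lineMap_append, lineMap_replicate]

lemma wordMap_squareWord_snd (i K Q : ℕ) (w v : List ℕ) (p : ℝ × ℝ) :
    (lgWordMap D (squareWord i K Q w v) p).2 =
      D.b i ^ (K + w.length + Q) * lineMap D.b D.d v p.2 +
        lineMap D.b D.d (List.replicate (K + w.length + Q) i) 0 := by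
  have : (squareWord i K Q w v).map Prod.fst = List.replicate (K + w.length + Q) i ++ v := by
    simp [squareWord, Function.comp_def, List.map_const', ← List.append_assoc,
      List.replicate_append_replicate]
  rw [D.wordMap_snd, this, lineMap_append, lineMap_replicate]

end LGData

lemma abs_affine_sub_le {κ s t e : ℝ} (hκ : 0 ≤ κ) (hs : s ∈ Icc (0 : ℝ) 1)
    (ht : t ∈ Icc (0 : ℝ) 1) : |κ * s + e - (κ * t + e)| ≤ κ := by
  rw [show κ * s + e - (κ * t + e) = κ * (s - t) by ring, abs_mul, abs_of_nonneg hκ]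
  refine mul_le_of_le_one_right hκ (abs_le.2 ⟨?_, ?_⟩) <;> linarith [hs.1, hs.2, ht.1, ht.2]

lemma mem_Icc_of_abs_affine_le {κ t e y r s : ℝ} (hκ : 0 < κ) (h : |κ * t + e - y| ≤ r)
    (hr : r ≤ κ * s) : t ∈ Icc ((y - e) / κ - s) ((y - e) / κ + s) := by
  obtain ⟨h₁, h₂⟩ := abs_le.1 h
  rw [mem_Icc, sub_le_iff_le_add, div_le_iff₀ hκ, ← sub_le_iff_le_add, le_div_iff₀ hκ]
  constructor <;> linarith

/-- Arbitrarily deep approximate squares of the carpet resemble a product, so that covering one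
of side `R` at scale `ρ * R` takes a multiple of `ρ ^ (-(βx + βy))` balls. -/
lemma LGData.exists_cover_lower_bound (D : LGData) {βx βy : ℝ} {i : ℕ} (hi : i < D.m)
    (hβy : βy ∈ Ioc (0 : ℝ) 1) (hsumy : ∑ i ∈ Finset.range D.m, D.b i ^ βy = 1)
    (hβx : βx ∈ Ioc (0 : ℝ) 1) (hsumx : ∑ j ∈ Finset.range (D.n i), D.a i j ^ βx = 1) :
    ∃ C > 0, ∀ ρ, 0 < ρ → ρ ≤ 1 → ∃ x ∈ lgCarpet D, ∃ R > 0,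
      ∀ F : Finset (EuclideanSpace ℝ (Fin 2)),
        lgCarpet D ∩ ball x (2 * R) ⊆ ⋃ y ∈ F, ball y (ρ * R) →
          1 ≤ F.card * (C * ρ ^ (βx + βy)) := by
  have hX := D.isOrderedIFS_row hi
  have hY := D.isOrderedIFS_rows
  have hb := D.b_pos hi
  obtain ⟨Cx, hCx, hx⟩ := hX.exists_wordMean_hitting_le hβx.1.le hβx.2 hsumx (s := 1) (by simp)
  obtain ⟨Cy, hCy, hy⟩ := hY.exists_wordMean_hitting_le hβy.1.le hβy.2 hsumy
    (s := (D.b i)⁻¹) (by positivity)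
  refine ⟨Cx * Cy, by positivity, fun ρ hρ hρ1 => ?_⟩
  obtain ⟨N, hN⟩ := hx ρ hρ hρ1
  obtain ⟨M, hM⟩ := hy ρ hρ hρ1
  obtain ⟨K, Q, hle, hge⟩ := D.exists_balanced_lengths hi N
  have hn0 := D.hn_one i hi
  have hz := D.fixedPoint_mem hi
  have hpx : ∀ j < D.n i, 0 ≤ D.a i j ^ βx := fun j hj =>
    Real.rpow_nonneg (hX.pos j hj).le _
  have hpy : ∀ k < D.m, 0 ≤ D.b k ^ βy := fun k hk => Real.rpow_nonneg (hY.pos k hk).le _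
  set z := D.fixedPoint i
  set R := D.a i 0 ^ K
  set H := D.b i ^ (K + N + Q)
  set ex := lineMap (D.a i) (D.c i) (List.replicate K 0) 0
  set ey := lineMap D.b D.d (List.replicate (K + N + Q) i) 0
  have hR : 0 < R := pow_pos (hX.pos 0 hn0) K
  have hH : 0 < H := pow_pos hb _
  set P : List ℕ → List ℕ → EuclideanSpace ℝ (Fin 2) := fun w v =>
    toE (lgWordMap D (LGData.squareWord i K Q w v) z) with hP
  have hPx : ∀ w v : List ℕ, (∀ k ∈ v, k < D.m) →
      ∃ t ∈ Icc (0 : ℝ) 1, P w v 0 = R * lineMap (D.a i) (D.c i) w t + ex := fun w v hv =>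
    LGData.wordMap_squareWord_fst hi K Q hv hz
  have hPy : ∀ w v : List ℕ, w.length = N →
      P w v 1 = H * lineMap D.b D.d v z.2 + ey := by
    intro w v hw
    simp only [hP, toE_apply_one, LGData.wordMap_squareWord_snd, hw, H, ey]
  have hPmem : ∀ w v : List ℕ, (∀ j ∈ w, j < D.n i) → (∀ k ∈ v, k < D.m) →
      P w v ∈ lgCarpet D := fun w v hw hv =>
    D.toE_wordMap_fixedPoint_mem hi (LGData.isWord_squareWord hi K Q hw hv)
  have hw₀ : ∀ j ∈ List.replicate N 0, j < D.n i := fun j hj => by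
    rw [List.eq_of_mem_replicate hj]; exact hn0
  refine ⟨P (List.replicate N 0) [], hPmem _ _ hw₀ (by simp), R, hR, fun F hF => ?_⟩
  have hcover : ∀ w v : List ℕ, w.length = N → (∀ j ∈ w, j < D.n i) → (∀ k ∈ v, k < D.m) →
      ∃ y ∈ F, P w v ∈ ball y (ρ * R) := by
    intro w v hwN hw hv
    have hball : P w v ∈ ball (P (List.replicate N 0) []) (2 * R) := by
      rw [mem_ball]
      refine dist_lt_of_coords hR fun k => ?_
      fin_cases k
      · obtain ⟨t, ht, e⟩ := hPx w v hv
        obtain ⟨t₀, ht₀, e₀⟩ := hPx (List.replicate N 0) [] (by simp)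
        simp only [Fin.zero_eta, e, e₀]
        exact abs_affine_sub_le hR.le (lineMap_mem_Icc hX.mapsTo hw ht)
          (lineMap_mem_Icc hX.mapsTo hw₀ ht₀)
      · simp only [Fin.mk_one, hPy w v hwN, hPy (List.replicate N 0) [] (by simp)]
        exact (abs_affine_sub_le hH.le (lineMap_mem_Icc hY.mapsTo hv hz.2) hz.2).trans hle
    simpa using hF ⟨hPmem w v hw hv, hball⟩
  set A : EuclideanSpace ℝ (Fin 2) → List ℕ → ℝ := fun y =>
    (hitting (D.a i) (D.c i) ((y 0 - ex) / R - 1 * ρ) ((y 0 - ex) / R + 1 * ρ)).indicator 1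
  set B : EuclideanSpace ℝ (Fin 2) → List ℕ → ℝ := fun y =>
    (hitting D.b D.d ((y 1 - ey) / H - (D.b i)⁻¹ * ρ)
      ((y 1 - ey) / H + (D.b i)⁻¹ * ρ)).indicator 1
  have hA0 : ∀ y w, 0 ≤ A y w := fun y w => Set.indicator_nonneg (by simp) _
  have hB0 : ∀ y v, 0 ≤ B y v := fun y v => Set.indicator_nonneg (by simp) _
  have hone : ∀ w v : List ℕ, w.length = N → (∀ j ∈ w, j < D.n i) → (∀ k ∈ v, k < D.m) →
      1 ≤ ∑ y ∈ F, A y w * B y v := by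
    intro w v hwN hw hv
    obtain ⟨y, hy, hmem⟩ := hcover w v hwN hw hv
    refine le_trans (le_of_eq ?_) (Finset.single_le_sum
      (f := fun y => A y w * B y v) (fun y _ => mul_nonneg (hA0 y w) (hB0 y v)) hy)
    have hd := fun k => (abs_coord_sub_le_dist (P w v) y k).trans (mem_ball.1 hmem).le
    have h₁ : A y w = 1 := by
      obtain ⟨t, ht, e⟩ := hPx w v hv
      have hmem := mem_Icc_of_abs_affine_le (s := 1 * ρ) hR (e ▸ hd 0) (by linarith)
      exact Set.indicator_of_mem (show w ∈ hitting _ _ _ _ from ⟨t, ht, hmem⟩) _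
    have h₂ : B y v = 1 := by
      have hRH : R ≤ H * (D.b i)⁻¹ := by rw [← div_eq_mul_inv, le_div_iff₀ hb]; linarith
      have hmem := mem_Icc_of_abs_affine_le (s := (D.b i)⁻¹ * ρ) hH (hPy w v hwN ▸ hd 1)
        (by nlinarith)
      exact Set.indicator_of_mem (show v ∈ hitting _ _ _ _ from ⟨z.2, hz.2, hmem⟩) _
    simp [h₁, h₂]
  calc (1 : ℝ) = wordMean (D.n i) (fun j => D.a i j ^ βx) N fun _ =>
          wordMean D.m (fun k => D.b k ^ βy) M fun _ => 1 := by
        rw [wordMean_const hsumy, wordMean_const hsumx]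
    _ ≤ wordMean (D.n i) (fun j => D.a i j ^ βx) N fun w =>
          wordMean D.m (fun k => D.b k ^ βy) M fun v => ∑ y ∈ F, A y w * B y v :=
        wordMean_mono hpx fun w hwN hw => wordMean_mono hpy fun v _ hv => hone w v hwN hw hv
    _ = ∑ y ∈ F, wordMean D.m (fun k => D.b k ^ βy) M (B y) *
          wordMean (D.n i) (fun j => D.a i j ^ βx) N (A y) := by
        simp only [wordMean_sum, wordMean_const_mul]
        refine Finset.sum_congr rfl fun y _ => ?_
        rw [← wordMean_const_mul]
        simp only [mul_comm]
    _ ≤ ∑ y ∈ F, Cy * ρ ^ βy * (Cx * ρ ^ βx) := by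
        refine Finset.sum_le_sum fun y _ => mul_le_mul (hM _) (hN _) ?_ (by positivity)
        exact (wordMean_const hsumx N 0).symm.le.trans (wordMean_mono hpx fun w _ _ => hA0 y w)
    _ = F.card * (Cx * Cy * ρ ^ (βx + βy)) := by
        rw [Finset.sum_const, nsmul_eq_mul, Real.rpow_add hρ]
        ring

/-- The Assouad dimension of a Lalley–Gatzouras carpet is at least `β_x + β_y`. -/
theorem lg_assouadDim_ge (D : LGData)

    (βx βy : ℝ)
    (hβy_mem : βy ∈ Set.Ioc (0 : ℝ) 1)
    (hβy_eq : ∑ i ∈ Finset.range D.m, D.b i ^ βy = 1)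
    (hβx_mem : βx ∈ Set.Ioc (0 : ℝ) 1)
    (hβx_eq : ∃ i, i < D.m ∧ ∑ j ∈ Finset.range (D.n i), D.a i j ^ βx = 1)
    (hβx_max : ∀ α ∈ Set.Ioc (0 : ℝ) 1,
      (∃ i, i < D.m ∧ ∑ j ∈ Finset.range (D.n i), D.a i j ^ α = 1) → α ≤ βx) :
    βx + βy ≤ assouadDim (lgCarpet D) := by
  obtain ⟨i, hi, hsumx⟩ := hβx_eq
  obtain ⟨C', hC', hlow⟩ := D.exists_cover_lower_bound hi hβy_mem hβy_eq hβx_mem hsumx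
  refine le_csInf ⟨2, by norm_num, 49, by norm_num, fun x _ r R hr hrR => ?_⟩ ?_
  · obtain ⟨F, hF, hcov⟩ := exists_finset_cover_ball x hr hrR
    exact ⟨F, hF, inter_subset_right.trans hcov⟩
  · rintro α ⟨-, C, hC, hup⟩
    by_contra! hlt
    set γ := βx + βy - α with hγ
    have hγ0 : 0 < γ := by linarith
    have key : ∀ ρ : ℝ, 0 < ρ → ρ ≤ 1 → 1 ≤ C * C' * 2 ^ α * ρ ^ γ := by
      intro ρ hρ hρ1
      obtain ⟨x, hx, R, hR, hbound⟩ := hlow ρ hρ hρ1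
      obtain ⟨F, hF, hcov⟩ := hup x hx (ρ * R) (2 * R) (by positivity) (by nlinarith)
      refine (hbound F hcov).trans ((mul_le_mul_of_nonneg_right hF (by positivity)).trans
        (le_of_eq ?_))
      rw [mul_div_mul_right _ _ hR.ne', Real.div_rpow zero_le_two hρ.le, hγ,
        Real.rpow_sub hρ (βx + βy) α]
      ring
    have hlim : Tendsto (fun ρ : ℝ => C * C' * 2 ^ α * ρ ^ γ) (nhdsWithin 0 (Ioi 0))
        (nhds (C * C' * 2 ^ α * 0 ^ γ)) :=
      (((Real.continuous_rpow_const hγ0.le).tendsto 0).const_mul _).mono_left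
        nhdsWithin_le_nhds
    have hev : ∀ᶠ ρ : ℝ in nhdsWithin 0 (Ioi 0), 1 ≤ C * C' * 2 ^ α * ρ ^ γ := by
      filter_upwards [Ioc_mem_nhdsGT (zero_lt_one (α := ℝ))] with ρ hρ using key ρ hρ.1 hρ.2
    have := ge_of_tendsto hlim hev
    rw [Real.zero_rpow hγ0.ne'] at this
    linarith
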